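/- arXiv:2312.06437 — 2 statements merged into one kernel-verified Lean document; each statement's English description precedes it below -/
import Mathlib

section
/- All mixed second partial derivatives of the multinomial log-likelihood vanish in the conditional-probability parameterization: for all indices i ≠ j in {1, …, w−1} and all Z ∈ (0,1)^{w-1}, ∂²ℓ/∂Z_i ∂Z_j (Z) = 0. (Consequently the off-diagonal entries of the Fisher information matrix for (Z_1, …, Z_{w-1}) are zero, i.e., the Fisher information matrix is diagonal.) -/
/-- The multinomial log-likelihood in the conditional-probability
parameterization (0-indexed): `ℓ(Z) = ∑_{v < w} y v * log (p v Z)` where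
`p v Z = Z v * ∏_{t < v} (1 - Z t)` for `v < w - 1` and
`p (w-1) Z = ∏_{t < w-1} (1 - Z t)` (the final conditional probability is 1). -/
noncomputable def mlogLik (w : ℕ) (y Z : ℕ → ℝ) : ℝ :=
  ∑ v ∈ Finset.range w,
    y v * Real.log ((if v < w - 1 then Z v else 1) * ∏ t ∈ Finset.range v, (1 - Z t))

open Finset in
/-- On points with all coordinates in `(0, 1)` the logarithm turns the log-likelihood into a sum of
functions of single coordinates. -/
theorem mlogLik_eq_sum_log {w : ℕ} (y : ℕ → ℝ) {Z : ℕ → ℝ}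
    (hZ : ∀ v ∈ range (w - 1), Z v ∈ Set.Ioo (0 : ℝ) 1) :
    mlogLik w y Z = ∑ v ∈ range w,
      y v * ((if v < w - 1 then Real.log (Z v) else 0) + ∑ t ∈ range v, Real.log (1 - Z t)) := by
  refine sum_congr rfl fun v hv => ?_
  have hv' : v < w := mem_range.1 hv
  have h1 : ∀ t ∈ range v, 1 - Z t ≠ 0 := fun t ht => by
    have := (hZ t (mem_range.2 (by have := mem_range.1 ht; omega))).2
    linarith
  have h0 : (if v < w - 1 then Z v else 1) ≠ 0 := by
    split_ifs with h
    · exact (hZ v (mem_range.2 h)).1.ne'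
    · exact one_ne_zero
  rw [Real.log_mul h0 (prod_ne_zero_iff.2 h1), Real.log_prod h1, apply_ite Real.log, Real.log_one]

/-- Updating two distinct coordinates changes a function of a single coordinate additively. -/
theorem apply_update_update_of_ne {i j : ℕ} (hij : i ≠ j) (f : ℝ → ℝ) (Z : ℕ → ℝ) (s t : ℝ)
    (v : ℕ) :
    f (Function.update (Function.update Z j s) i t v) =
      f (Function.update Z i t v) + (f (Function.update Z j s v) - f (Z v)) := by
  rcases eq_or_ne v i with rfl | hi
  · simp [hij]
  · simp [hi]

theorem update_mem_Ioo {w i : ℕ} {Z : ℕ → ℝ} {t : ℝ} (ht : t ∈ Set.Ioo (0 : ℝ) 1)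
    (hZ : ∀ v ∈ Finset.range w, Z v ∈ Set.Ioo (0 : ℝ) 1) :
    ∀ v ∈ Finset.range w, Function.update Z i t v ∈ Set.Ioo (0 : ℝ) 1 := fun v hv => by
  rcases eq_or_ne v i with rfl | h
  · simpa using ht
  · simpa [h] using hZ v hv

/-- The log-likelihood is separable: the effects of updating two distinct coordinates add up. -/
theorem mlogLik_update_update {w : ℕ} (y : ℕ → ℝ) {i j : ℕ} (hij : i ≠ j) {Z : ℕ → ℝ}
    (hZ : ∀ v ∈ Finset.range (w - 1), Z v ∈ Set.Ioo (0 : ℝ) 1) {s t : ℝ}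
    (hs : s ∈ Set.Ioo (0 : ℝ) 1) (ht : t ∈ Set.Ioo (0 : ℝ) 1) :
    mlogLik w y (Function.update (Function.update Z j s) i t) =
      mlogLik w y (Function.update Z i t) +
        (mlogLik w y (Function.update Z j s) - mlogLik w y Z) := by
  rw [mlogLik_eq_sum_log y (update_mem_Ioo ht (update_mem_Ioo hs hZ)),
    mlogLik_eq_sum_log y (update_mem_Ioo ht hZ), mlogLik_eq_sum_log y (update_mem_Ioo hs hZ),
    mlogLik_eq_sum_log y hZ, ← Finset.sum_sub_distrib, ← Finset.sum_add_distrib]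
  refine Finset.sum_congr rfl fun v _ => ?_
  simp only [apply_update_update_of_ne hij Real.log,
    apply_update_update_of_ne hij (fun x => Real.log (1 - x)), Finset.sum_add_distrib,
    Finset.sum_sub_distrib]
  split_ifs <;> ring

/-- All mixed second partial derivatives of the multinomial
log-likelihood vanish in the conditional-probability parameterization: for all
indices `i ≠ j` in `{1, …, w-1}` (0-indexed: `i, j < w - 1`) and all
`Z ∈ (0,1)^{w-1}`, `∂²ℓ/∂Z_i∂Z_j (Z) = 0`.  (Consequently the off-diagonal
entries of the Fisher information matrix for `(Z_1, …, Z_{w-1})` are zero, i.e.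
the Fisher information matrix is diagonal.) -/
theorem multinomial_logLik_mixed_partials_vanish
    (w : ℕ) (hw : 2 ≤ w) (y : ℕ → ℝ)
    (hy : ∀ v ∈ Finset.range w, 0 ≤ y v)
    (i j : ℕ) (hi : i < w - 1) (hj : j < w - 1) (hij : i ≠ j)
    (Z : ℕ → ℝ) (hZ : ∀ v ∈ Finset.range (w - 1), Z v ∈ Set.Ioo (0 : ℝ) 1) :
    deriv
      (fun s =>
        deriv (fun t => mlogLik w y (Function.update (Function.update Z j s) i t))
          (Z i))
      (Z j) = 0 := by
  have hnhds : ∀ k < w - 1, Set.Ioo (0 : ℝ) 1 ∈ nhds (Z k) := fun k hk =>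
    isOpen_Ioo.mem_nhds (hZ k (Finset.mem_range.2 hk))
  have hconst : (fun s =>
        deriv (fun t => mlogLik w y (Function.update (Function.update Z j s) i t)) (Z i))
      =ᶠ[nhds (Z j)] fun _ => deriv (fun t => mlogLik w y (Function.update Z i t)) (Z i) := by
    filter_upwards [hnhds j hj] with s hs
    have hsep : (fun t => mlogLik w y (Function.update (Function.update Z j s) i t))
        =ᶠ[nhds (Z i)] fun t => mlogLik w y (Function.update Z i t) +
          (mlogLik w y (Function.update Z j s) - mlogLik w y Z) := by
      filter_upwards [hnhds i hi] with t ht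
      exact mlogLik_update_update y hij hZ hs ht
    rw [hsep.deriv_eq, deriv_add_const]
  rw [hconst.deriv_eq, deriv_const]
end

section
/- The log-density of the bivariate t-copula with identity correlation matrix and ν = 4 degrees of freedom has a saddle point at the quantile point corresponding to x = (1, 1): for h(x_1, x_2) = −3·log(1 + (x_1² + x_2²)/4) + (5/2)·log(1 + x_1²/4) + (5/2)·log(1 + x_2²/4), the gradient of h at (1, 1) is zero, the Hessian of h at (1, 1) equals the matrix [[−1/15, 1/3], [1/3, −1/15]], whose determinant 1/225 − 1/9 is negative; consequently the second directional derivative of h at (1, 1) is positive in the direction (1, 1) and negative in the direction (1, −1), so h has neither a local maximum nor a local minimum at (1, 1). -/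
/-- The log-density (up to an additive constant) of the bivariate t-copula with
identity correlation matrix and `ν = 4` degrees of freedom, in the quantile
coordinates `x j = T₄⁻¹ (u j)`:
`h(x₁,x₂) = -3 log(1 + (x₁² + x₂²)/4) + (5/2) log(1 + x₁²/4) + (5/2) log(1 + x₂²/4)`. -/
noncomputable def tCopulaLogDensity (p : ℝ × ℝ) : ℝ :=
  -3 * Real.log (1 + (p.1 ^ 2 + p.2 ^ 2) / 4)
    + (5 / 2) * Real.log (1 + p.1 ^ 2 / 4)
    + (5 / 2) * Real.log (1 + p.2 ^ 2 / 4)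

/-- Second derivative test for the failure of a local maximum. -/
lemma not_isLocalMax_of_deriv_deriv_pos {f : ℝ → ℝ} {x₀ : ℝ} (hf : 0 < deriv (deriv f) x₀)
    (hd : deriv f x₀ = 0) (hc : ContinuousAt f x₀) : ¬ IsLocalMax f x₀ := by
  intro hmax
  have hconst : f =ᶠ[nhds x₀] fun _ => f x₀ := by
    filter_upwards [hmax, isLocalMin_of_deriv_deriv_pos hf hd hc] with x h₁ h₂
    exact le_antisymm h₁ h₂
  have hzero := hconst.deriv.deriv_eq
  simp only [deriv_const', deriv_const] at hzero
  exact hf.ne' hzero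

/-- Second derivative test for the failure of a local minimum. -/
lemma not_isLocalMin_of_deriv_deriv_neg {f : ℝ → ℝ} {x₀ : ℝ} (hf : deriv (deriv f) x₀ < 0)
    (hd : deriv f x₀ = 0) (hc : ContinuousAt f x₀) : ¬ IsLocalMin f x₀ := by
  intro hmin
  have hconst : f =ᶠ[nhds x₀] fun _ => f x₀ := by
    filter_upwards [hmin, isLocalMax_of_deriv_deriv_neg hf hd hc] with x h₁ h₂
    exact le_antisymm h₂ h₁
  have hzero := hconst.deriv.deriv_eq
  simp only [deriv_const', deriv_const] at hzero
  exact hf.ne hzero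

lemma hasDerivAt_tCopulaLogDensity_comp {a b : ℝ → ℝ} {r s t : ℝ}
    (ha : HasDerivAt a r t) (hb : HasDerivAt b s t) :
    HasDerivAt (fun t => tCopulaLogDensity (a t, b t))
      (-6 * ((a t * r + b t * s) / (4 + a t ^ 2 + b t ^ 2))
        + 5 * (a t * r / (4 + a t ^ 2)) + 5 * (b t * s / (4 + b t ^ 2))) t := by
  have h₁ := ((((ha.pow 2).add (hb.pow 2)).div_const 4).const_add 1).log
    (by simp only [Pi.add_apply, Pi.pow_apply]; positivity)
  have h₂ := (((ha.pow 2).div_const 4).const_add 1).log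
    (by simp only [Pi.pow_apply]; positivity)
  have h₃ := (((hb.pow 2).div_const 4).const_add 1).log
    (by simp only [Pi.pow_apply]; positivity)
  refine (((h₁.const_mul (-3)).add (h₂.const_mul (5 / 2))).add
    (h₃.const_mul (5 / 2))).congr_deriv ?_
  simp only [Pi.add_apply, Pi.pow_apply]
  have e₁ : 1 + (a t ^ 2 + b t ^ 2) / 4 = (4 + a t ^ 2 + b t ^ 2) / 4 := by ring
  have e₂ : 1 + a t ^ 2 / 4 = (4 + a t ^ 2) / 4 := by ring
  have e₃ : 1 + b t ^ 2 / 4 = (4 + b t ^ 2) / 4 := by ring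
  rw [e₁, e₂, e₃]
  simp only [div_eq_mul_inv, mul_inv, inv_inv]
  push_cast
  ring

lemma deriv_tCopulaLogDensity_comp {a b : ℝ → ℝ} {r s : ℝ}
    (ha : ∀ t, HasDerivAt a r t) (hb : ∀ t, HasDerivAt b s t) :
    deriv (fun t => tCopulaLogDensity (a t, b t)) = fun t =>
      -6 * ((a t * r + b t * s) / (4 + a t ^ 2 + b t ^ 2))
        + 5 * (a t * r / (4 + a t ^ 2)) + 5 * (b t * s / (4 + b t ^ 2)) :=
  funext fun t => (hasDerivAt_tCopulaLogDensity_comp (ha t) (hb t)).deriv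

lemma deriv_deriv_tCopulaLogDensity_comp {a b : ℝ → ℝ} {r s : ℝ}
    (ha : ∀ t, HasDerivAt a r t) (hb : ∀ t, HasDerivAt b s t) (t : ℝ) :
    deriv (deriv (fun t => tCopulaLogDensity (a t, b t))) t =
      -6 * (((r * r + s * s) * (4 + a t ^ 2 + b t ^ 2)
          - (a t * r + b t * s) * (2 * a t * r + 2 * b t * s)) / (4 + a t ^ 2 + b t ^ 2) ^ 2)
        + 5 * ((r * r * (4 + a t ^ 2) - a t * r * (2 * a t * r)) / (4 + a t ^ 2) ^ 2)
        + 5 * ((s * s * (4 + b t ^ 2) - b t * s * (2 * b t * s)) / (4 + b t ^ 2) ^ 2) := by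
  rw [deriv_tCopulaLogDensity_comp ha hb]
  have ha₂ : HasDerivAt (fun t => 4 + a t ^ 2) (2 * a t * r) t := by
    simpa using ((ha t).fun_pow 2).const_add 4
  have hb₂ : HasDerivAt (fun t => b t ^ 2) (2 * b t * s) t := by
    simpa using (hb t).fun_pow 2
  have har := (ha t).mul_const r
  have hbs := (hb t).mul_const s
  exact ((((har.fun_add hbs).fun_div (ha₂.fun_add hb₂) (by positivity)).const_mul (-6)).fun_add
    ((har.fun_div ha₂ (by positivity)).const_mul 5)).fun_add
    ((hbs.fun_div (hb₂.const_add 4) (by positivity)).const_mul 5) |>.deriv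

/-- The log-density of the bivariate t-copula with identity
correlation matrix and `ν = 4` degrees of freedom has a saddle point at the
quantile point corresponding to `x = (1, 1)`: the gradient of `h` at `(1, 1)` is
zero, the Hessian of `h` at `(1, 1)` equals `[[-1/15, 1/3], [1/3, -1/15]]`,
whose determinant `1/225 - 1/9` is negative; consequently the second directional
derivative of `h` at `(1, 1)` is positive in the direction `(1, 1)` and negative
in the direction `(1, -1)`, so `h` has neither a local maximum nor a local
minimum at `(1, 1)`. -/
theorem tCopulaLogDensity_saddle_point_at_one_one :
    deriv (fun x => tCopulaLogDensity (x, 1)) 1 = 0 ∧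
      deriv (fun y => tCopulaLogDensity (1, y)) 1 = 0 ∧
      deriv (deriv (fun x => tCopulaLogDensity (x, 1))) 1 = -1 / 15 ∧
      deriv (deriv (fun y => tCopulaLogDensity (1, y))) 1 = -1 / 15 ∧
      deriv (fun y => deriv (fun x => tCopulaLogDensity (x, y)) 1) 1 = 1 / 3 ∧
      ((-1 / 15 : ℝ) * (-1 / 15) - (1 / 3) * (1 / 3) = 1 / 225 - 1 / 9 ∧
        (1 / 225 : ℝ) - 1 / 9 < 0) ∧
      0 < deriv (deriv (fun t => tCopulaLogDensity (1 + t, 1 + t))) 0 ∧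
      deriv (deriv (fun t => tCopulaLogDensity (1 + t, 1 - t))) 0 < 0 ∧
      ¬ IsLocalMax tCopulaLogDensity (1, 1) ∧
      ¬ IsLocalMin tCopulaLogDensity (1, 1) := by
  have hid : ∀ t : ℝ, HasDerivAt (fun t => t) 1 t := hasDerivAt_id'
  have hone : ∀ t : ℝ, HasDerivAt (fun _ => (1 : ℝ)) 0 t := fun t => hasDerivAt_const t 1
  have hadd : ∀ t : ℝ, HasDerivAt (fun t => 1 + t) 1 t := fun t => (hid t).const_add 1
  have hsub : ∀ t : ℝ, HasDerivAt (fun t => 1 - t) (-1) t := fun t => (hid t).const_sub 1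
  have hdiag : 0 < deriv (deriv (fun t => tCopulaLogDensity (1 + t, 1 + t))) 0 := by
    rw [deriv_deriv_tCopulaLogDensity_comp hadd hadd]
    norm_num
  have hanti : deriv (deriv (fun t => tCopulaLogDensity (1 + t, 1 - t))) 0 < 0 := by
    rw [deriv_deriv_tCopulaLogDensity_comp hadd hsub]
    norm_num
  refine ⟨?_, ?_, ?_, ?_, ?_, by norm_num, hdiag, hanti, ?_, ?_⟩
  · rw [deriv_tCopulaLogDensity_comp hid hone]
    norm_num
  · rw [deriv_tCopulaLogDensity_comp hone hid]
    norm_num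
  · rw [deriv_deriv_tCopulaLogDensity_comp hid hone]
    norm_num
  · rw [deriv_deriv_tCopulaLogDensity_comp hone hid]
    norm_num
  · have hx : (fun y => deriv (fun x => tCopulaLogDensity (x, y)) 1) =
        fun y => -6 * (1 / (5 + y ^ 2)) + 1 := by
      funext y
      rw [deriv_tCopulaLogDensity_comp hid fun t => hasDerivAt_const t y]
      norm_num
    have hden : HasDerivAt (fun y : ℝ => 5 + y ^ 2) 2 1 := by
      simpa using ((hid 1).fun_pow 2).const_add 5
    rw [hx, ((((hone 1).fun_div hden (by norm_num)).const_mul (-6)).add_const 1).deriv]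
    norm_num
  · intro hmax
    refine not_isLocalMax_of_deriv_deriv_pos hdiag ?_
      (hasDerivAt_tCopulaLogDensity_comp (hadd 0) (hadd 0)).continuousAt ?_
    · rw [deriv_tCopulaLogDensity_comp hadd hadd]
      norm_num
    · exact IsLocalMax.comp_continuous (g := fun t : ℝ => (1 + t, 1 + t)) (b := 0)
        (by simpa using hmax) (by fun_prop)
  · intro hmin
    refine not_isLocalMin_of_deriv_deriv_neg hanti ?_
      (hasDerivAt_tCopulaLogDensity_comp (hadd 0) (hsub 0)).continuousAt ?_
    · rw [deriv_tCopulaLogDensity_comp hadd hsub]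
      norm_num
    · exact IsLocalMin.comp_continuous (g := fun t : ℝ => (1 + t, 1 - t)) (b := 0)
        (by simpa using hmin) (by fun_prop)
end
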